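/- Let γ ∈ (0,1), c : S × S → ℝ, and α ∈ [0,1]. Then the robust-MDP value equals the two-player game value: inf over player policies π_pl of sup { J(π_pl, U) : U ∈ 𝒯^α } equals inf over player policies π_pl of sup { J(α·π_pl + (1−α)·π_op, T) : π_op a policy }. (Both inner suprema are over nonempty sets of reals bounded above by (max_{s,s'} |c(s,s')|)/(1−γ), so they are well-defined as suprema in ℝ.) -/

import Mathlib

open Finset

/-- A policy: nonnegative and sums to one over actions at every state. -/
def IsPolicy {S A : Type*} [Fintype A] (π : S → A → ℝ) : Prop :=
  (∀ s a, 0 ≤ π s a) ∧ ∀ s, ∑ a, π s a = 1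

/-- A transition kernel: nonnegative and sums to one over next states. -/
def IsKernel {S A : Type*} [Fintype S] (U : S → A → S → ℝ) : Prop :=
  (∀ s a s', 0 ≤ U s a s') ∧ ∀ s a, ∑ s', U s a s' = 1

/-- An initial distribution over states. -/
def IsDist {S : Type*} [Fintype S] (P0 : S → ℝ) : Prop :=
  (∀ s, 0 ≤ P0 s) ∧ ∑ s, P0 s = 1

/-- The perturbed kernel `T^α[π_op]`. -/
def perturb {S A : Type*} [Fintype A] (T : S → A → S → ℝ) (πop : S → A → ℝ) (α : ℝ) :
    S → A → S → ℝ :=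
  fun s a s' => α * T s a s' + (1 - α) * ∑ b, πop s b * T s b s'

/-- The mixed policy `α·π_pl + (1−α)·π_op`. -/
def mix {S A : Type*} (πpl πop : S → A → ℝ) (α : ℝ) : S → A → ℝ :=
  fun s a => α * πpl s a + (1 - α) * πop s a

/-- The time-`t` state marginal of the Markov chain induced by policy `π` and kernel `U`
started at `P0`. -/
def marg {S A : Type*} [Fintype S] [Fintype A] (P0 : S → ℝ) (π : S → A → ℝ)
    (U : S → A → S → ℝ) : ℕ → S → ℝ
  | 0 => P0
  | t + 1 => fun s' => ∑ s, marg P0 π U t s * ∑ a, π s a * U s a s'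

/-- The infinite-horizon discounted return
`J(π,U) = ∑_t γ^t ∑_{s,s'} p_t(s) (∑_a π s a · U s a s') c(s,s')`. -/
noncomputable def discReturn {S A : Type*} [Fintype S] [Fintype A]
    (γ : ℝ) (c : S → S → ℝ) (P0 : S → ℝ) (π : S → A → ℝ) (U : S → A → S → ℝ) : ℝ :=
  ∑' t : ℕ, γ ^ t * ∑ s, ∑ s', marg P0 π U t s * (∑ a, π s a * U s a s') * c s s'

theorem step_eq {S A : Type*} [Fintype S] [Fintype A] (T : S → A → S → ℝ)
    (πpl πop : S → A → ℝ) (h : IsPolicy πpl) (α : ℝ) (s s' : S) :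
    ∑ a, πpl s a * perturb T πop α s a s' = ∑ a, mix πpl πop α s a * T s a s' := by
  simp only [perturb, mix, mul_add, add_mul, Finset.sum_add_distrib]
  congr 1
  · exact Finset.sum_congr rfl fun a _ => by ring
  · rw [← Finset.sum_mul, h.2 s, one_mul, Finset.mul_sum]
    exact Finset.sum_congr rfl fun a _ => by ring

theorem marg_eq {S A : Type*} [Fintype S] [Fintype A] (T : S → A → S → ℝ) (P0 : S → ℝ)
    (πpl πop : S → A → ℝ) (h : IsPolicy πpl) (α : ℝ) (t : ℕ) :
    marg P0 πpl (perturb T πop α) t = marg P0 (mix πpl πop α) T t := by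
  induction t with
  | zero => rfl
  | succ t ih => simp only [marg, ih, step_eq T πpl πop h]

theorem discReturn_eq {S A : Type*} [Fintype S] [Fintype A] (γ : ℝ) (c : S → S → ℝ)
    (T : S → A → S → ℝ) (P0 : S → ℝ)
    (πpl πop : S → A → ℝ) (h : IsPolicy πpl) (α : ℝ) :
    discReturn γ c P0 πpl (perturb T πop α) = discReturn γ c P0 (mix πpl πop α) T := by
  simp only [discReturn, marg_eq T P0 πpl πop h, step_eq T πpl πop h]

/-- The robust-MDP value equals the two-player game value: the inf over player policies of the
sup of returns over the uncertainty set `𝒯^α` equals the inf over player policies of the sup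
of returns of mixed policies over opponent policies. -/
theorem robust_value_eq_game_value
    {S A : Type*} [Fintype S] [Fintype A] [Nonempty S] [Nonempty A]
    (T : S → A → S → ℝ) (hT : IsKernel T)
    (P0 : S → ℝ) (hP0 : IsDist P0)
    (γ : ℝ) (hγ : γ ∈ Set.Ioo (0 : ℝ) 1) (c : S → S → ℝ)
    (α : ℝ) (hα : α ∈ Set.Icc (0 : ℝ) 1) :
    sInf {v : ℝ | ∃ πpl : S → A → ℝ, IsPolicy πpl ∧
        v = sSup {x : ℝ | ∃ U ∈ {V | ∃ πop : S → A → ℝ, IsPolicy πop ∧ V = perturb T πop α},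
          x = discReturn γ c P0 πpl U}}
      = sInf {v : ℝ | ∃ πpl : S → A → ℝ, IsPolicy πpl ∧
          v = sSup {x : ℝ | ∃ πop : S → A → ℝ, IsPolicy πop ∧
            x = discReturn γ c P0 (mix πpl πop α) T}} := by
  congr 1
  ext v
  refine exists_congr fun πpl => and_congr_right fun h => ?_
  have hset : {x : ℝ | ∃ U ∈ {V | ∃ πop : S → A → ℝ, IsPolicy πop ∧ V = perturb T πop α},
      x = discReturn γ c P0 πpl U} = {x : ℝ | ∃ πop : S → A → ℝ, IsPolicy πop ∧
            x = discReturn γ c P0 (mix πpl πop α) T} := by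
    ext x
    constructor
    · rintro ⟨U, ⟨πop, hop, rfl⟩, rfl⟩
      exact ⟨πop, hop, discReturn_eq γ c T P0 πpl πop h α⟩
    · rintro ⟨πop, hop, rfl⟩
      exact ⟨_, ⟨πop, hop, rfl⟩, (discReturn_eq γ c T P0 πpl πop h α).symm⟩
  rw [hset]
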